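/- Let q > 2 be a prime power and k a positive integer. For any b₁,…,b_k ∈ 𝔽_q, setting (a₁,…,a_k) := G(b₁,…,b_k), the following identity holds as permutations of ℙ¹(𝔽_q): (b₁,∞) ∘ (b₂,∞) ∘ ⋯ ∘ (b_k,∞) = μ ∘ ι ∘ τ_{a_k} ∘ ι ∘ τ_{a_{k−1}} ∘ ⋯ ∘ ι ∘ τ_{a₁}, where μ := σ_{a₁} ∘ Inv ∘ σ_{a₂} ∘ Inv ∘ ⋯ ∘ σ_{a_k} ∘ Inv (a permutation induced by a degree-one rational function). -/

import Mathlib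

theorem FiniteField.pow_card_sub_two_eq_inv {F : Type*} [Field F] [Fintype F]
    (hq : 2 < Fintype.card F) (a : F) : a ^ (Fintype.card F - 2) = a⁻¹ := by
  rcases eq_or_ne a 0 with rfl | ha
  · rw [zero_pow (by omega), inv_zero]
  · apply eq_inv_of_mul_eq_one_left
    rw [← pow_succ,
      show Fintype.card F - 2 + 1 = Fintype.card F - 1 by omega,
      FiniteField.pow_card_sub_one_eq_one a ha]

theorem Equiv.Perm.conj_prod_ofFn_swap {α : Type*} [DecidableEq α] (g : Equiv.Perm α) {m : ℕ}
    (u v : Fin m → α) :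
    g * (List.ofFn fun i => Equiv.swap (u i) (v i)).prod * g⁻¹
      = (List.ofFn fun i => Equiv.swap (g (u i)) (g (v i))).prod := by
  rw [← MulAut.conj_apply, map_list_prod, List.map_ofFn]
  congr 2
  funext i
  simp [Equiv.swap_apply_apply]


/-- The map G : 𝔽_q^k → 𝔽_q^k, where the i-th entry of `G(b)` is the first entry of
`(Φ_{k-i+2} ∘ ⋯ ∘ Φ_k)(b)`, with `Φ_ℓ(e₁,…,e_ℓ) = ((e₂−e₁)^{q−2}, …, (e_ℓ−e₁)^{q−2})`. -/
def Gvec {F : Type*} [Field F] (q : ℕ) : (m : ℕ) → (Fin m → F) → Fin m → F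
  | 0, _ => finZeroElim
  | m + 1, b => Fin.cons (b 0) (Gvec q m (fun j => (b j.succ - b 0) ^ (q - 2)))

/-- For b₁,…,b_k ∈ 𝔽_q and (a₁,…,a_k) := G(b₁,…,b_k),
(b₁,∞) ∘ ⋯ ∘ (b_k,∞) = μ ∘ ι ∘ τ_{a_k} ∘ ⋯ ∘ ι ∘ τ_{a₁} as permutations of ℙ¹(𝔽_q)
(modeled as `Option F` with `none` as ∞), where
μ = σ_{a₁} ∘ Inv ∘ σ_{a₂} ∘ Inv ∘ ⋯ ∘ σ_{a_k} ∘ Inv. -/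
theorem comb_to_alg_recipe
    {F : Type*} [Field F] [Fintype F] [DecidableEq F]
    (hq : 2 < Fintype.card F) (k : ℕ) (hk : 0 < k)
    (ι : Equiv.Perm (Option F))
    (hι_infty : ι none = none)
    (hι : ∀ a : F, ι (some a) = some (a ^ (Fintype.card F - 2)))
    (Inv : Equiv.Perm (Option F))
    (hInv_infty : Inv none = some 0)
    (hInv_zero : Inv (some 0) = none)
    (hInv : ∀ a : F, a ≠ 0 → Inv (some a) = some a⁻¹)
    (b : Fin k → F) :
    (List.ofFn (fun i : Fin k => Equiv.swap (some (b i)) none)).prod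
      = (List.ofFn (fun i : Fin k =>
            (Equiv.addRight (Gvec (Fintype.card F) k b i)).optionCongr * Inv)).prod
        * (List.ofFn (fun i : Fin k =>
            ι * (Equiv.subRight (Gvec (Fintype.card F) k b i.rev)).optionCongr)).prod := by
  clear hk
  have hι_inv (a : F) : ι (some a) = some a⁻¹ := by
    rw [hι, FiniteField.pow_card_sub_two_eq_inv hq]
  have hιι : ι⁻¹ = ι := by
    rw [inv_eq_iff_mul_eq_one]
    ext1 x
    cases x <;> simp [hι_infty, hι_inv]
  have hInvι : Inv * ι = Equiv.swap (some 0) none := by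
    ext1 x
    rcases x with _ | a
    · simp [hι_infty, hInv_infty]
    · rcases eq_or_ne a 0 with rfl | ha
      · simp [hι_inv, hInv_zero]
      · rw [Equiv.Perm.mul_apply, hι_inv, hInv _ (inv_ne_zero ha), inv_inv,
          Equiv.swap_apply_of_ne_of_ne (by simpa using ha) (by simp)]
  induction k with
  | zero => simp
  | succ m ih =>
    set c : Fin m → F := fun j => (b j.succ - b 0) ^ (Fintype.card F - 2) with hc
    set σ : Equiv.Perm (Option F) := (Equiv.addRight (b 0)).optionCongr with hσ
    have hτ : (Equiv.subRight (b 0)).optionCongr = σ⁻¹ := by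
      rw [eq_inv_iff_mul_eq_one]
      ext1 x
      cases x <;> simp [hσ]
    have hG_zero : Gvec (Fintype.card F) (m + 1) b 0 = b 0 := rfl
    have hG_succ (i : Fin m) :
        Gvec (Fintype.card F) (m + 1) b i.succ = Gvec (Fintype.card F) m c i := rfl
    have hσι (i : Fin m) : (σ * ι) (some (c i)) = some (b i.succ) := by
      simp [hσ, hc, hι_inv, FiniteField.pow_card_sub_two_eq_inv hq]
    have hσι_infty : (σ * ι) none = none := by simp [hσ, hι_infty]
    have hswap : Equiv.swap (some (b 0)) none = σ * (Inv * ι) * σ⁻¹ := by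
      rw [hInvι, ← Equiv.swap_apply_apply]
      simp [hσ]
    have hconj := Equiv.Perm.conj_prod_ofFn_swap (σ * ι) (fun i => some (c i)) fun _ => none
    simp only [hσι, hσι_infty] at hconj
    rw [List.ofFn_succ, List.prod_cons, ← hconj, ih c, hswap, List.ofFn_succ, List.prod_cons,
      List.ofFn_succ' (n := m), List.concat_eq_append, List.prod_append, List.prod_singleton]
    simp only [Fin.rev_last, Fin.rev_castSucc, hG_zero, hG_succ, hτ, ← hσ, mul_inv_rev, hιι]
    have hι_sq : ι * ι = 1 := by rwa [← inv_eq_iff_mul_eq_one]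
    simp only [mul_assoc, inv_mul_cancel_left]
    rw [← mul_assoc ι ι, hι_sq, one_mul]
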